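/- arXiv:1805.05182 — 5 statements merged into one kernel-verified Lean document; each statement's English description precedes it below -/
import Mathlib

section
/- Let ν₁ and ν₂ be Lévy measures on ℝ. Then there exists a unique pair (ν⁺, ν⁻) of mutually singular Lévy measures on ℝ such that ν⁺(B) − ν⁻(B) = ν₁(B) − ν₂(B) for every Borel set B ⊆ ℝ that is bounded away from zero, i.e., for every Borel B with B ∩ (−r, r) = ∅ for some r > 0 (equivalently, 0 not in the closure of B). -/
open MeasureTheory Set

/-- A Lévy measure on `ℝ`: a Borel measure `ν` with `ν {0} = 0` and
`∫ min(1, x²) ν(dx) < ∞`. -/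
def IsLevyMeasure (ν : MeasureTheory.Measure ℝ) : Prop :=
  ν {0} = 0 ∧ ∫⁻ x, ENNReal.ofReal (min 1 (x ^ 2)) ∂ν < ⊤

/-- A set `B ⊆ ℝ` is bounded away from zero if `B ∩ (−r, r) = ∅` for some `r > 0`. -/
def BoundedAwayFromZero (B : Set ℝ) : Prop :=
  ∃ r > (0 : ℝ), B ∩ Set.Ioo (-r) r = ∅

theorem IsLevyMeasure.mono {μ ν : Measure ℝ} (hν : IsLevyMeasure ν) (h : μ ≤ ν) :
    IsLevyMeasure μ :=
  ⟨le_antisymm ((h {0}).trans hν.1.le) zero_le, (lintegral_mono' h le_rfl).trans_lt hν.2⟩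

theorem IsLevyMeasure.measure_lt_top {ν : Measure ℝ} (hν : IsLevyMeasure ν) {B : Set ℝ}
    (hB : BoundedAwayFromZero B) : ν B < ⊤ := by
  obtain ⟨r, hr, hBr⟩ := hB
  have hpos : 0 < min 1 (r ^ 2) := by positivity
  have hsub : B ⊆ {x | ENNReal.ofReal (min 1 (r ^ 2)) ≤ ENNReal.ofReal (min 1 (x ^ 2))} := by
    intro x hx
    have hxr : r ≤ |x| := by
      by_contra! hlt
      have : x ∈ B ∩ Ioo (-r) r := ⟨hx, abs_lt.mp hlt⟩
      simp [hBr] at this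
    refine ENNReal.ofReal_le_ofReal (min_le_min le_rfl ?_)
    rw [← sq_abs x]
    gcongr
  refine (measure_mono hsub).trans_lt ?_
  refine (meas_ge_le_lintegral_div (by fun_prop) (ENNReal.ofReal_pos.mpr hpos).ne'
    ENNReal.ofReal_ne_top).trans_lt ?_
  exact ENNReal.div_lt_top hν.2.ne (ENNReal.ofReal_pos.mpr hpos).ne'

/-- The inequality of two measures can be tested on the sets bounded away from zero, provided
the smaller one does not charge zero. -/
theorem measure_le_of_forall_boundedAwayFromZero {μ ν : Measure ℝ} (hμ : μ {0} = 0)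
    (h : ∀ B, MeasurableSet B → BoundedAwayFromZero B → μ B ≤ ν B) : μ ≤ ν := by
  refine Measure.le_iff.mpr fun B hB ↦ ?_
  let A : ℕ → Set ℝ := fun n ↦ B ∩ {x | 1 / ((n : ℝ) + 1) ≤ |x|}
  have hA : Monotone A := by
    intro m n hmn x hx
    exact ⟨hx.1, le_trans (Nat.one_div_le_one_div hmn) (show 1 / ((m : ℝ) + 1) ≤ |x| from hx.2)⟩
  have hBA : B ⊆ {0} ∪ ⋃ n, A n := by
    intro x hx
    by_cases hx0 : x = 0
    · exact Or.inl hx0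
    · obtain ⟨n, hn⟩ := exists_nat_one_div_lt (abs_pos.mpr hx0)
      exact Or.inr (mem_iUnion.mpr ⟨n, hx, hn.le⟩)
  calc μ B ≤ μ {0} + μ (⋃ n, A n) := (measure_mono hBA).trans (measure_union_le _ _)
    _ = ⨆ n, μ (A n) := by rw [hμ, zero_add, hA.measure_iUnion]
    _ ≤ ν B := iSup_le fun n ↦ by
      refine (h (A n) (hB.inter (measurableSet_le (by fun_prop) (by fun_prop)))
        ⟨1 / ((n : ℝ) + 1), by positivity, ?_⟩).trans (measure_mono inter_subset_left)
      refine eq_empty_of_forall_notMem fun x hx ↦ ?_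
      exact absurd (abs_lt.mpr hx.2) (not_lt.mpr hx.1.2)

theorem IsLevyMeasure.sigmaFinite {ν : Measure ℝ} (hν : IsLevyMeasure ν) : SigmaFinite ν := by
  have hs (n : ℕ) : BoundedAwayFromZero {x : ℝ | 1 / ((n : ℝ) + 1) ≤ |x|} :=
    ⟨1 / ((n : ℝ) + 1), by positivity, eq_empty_of_forall_notMem fun x hx ↦
      absurd (abs_lt.mpr hx.2) (not_lt.mpr hx.1)⟩
  refine ⟨⟨⟨fun n ↦ {0} ∪ {x : ℝ | 1 / ((n : ℝ) + 1) ≤ |x|}, fun _ ↦ trivial, fun n ↦ ?_, ?_⟩⟩⟩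
  · exact measure_union_lt_top (by simp [hν.1]) (hν.measure_lt_top (hs n))
  · refine eq_univ_of_forall fun x ↦ mem_iUnion.mpr ?_
    by_cases hx0 : x = 0
    · exact ⟨0, Or.inl hx0⟩
    · obtain ⟨n, hn⟩ := exists_nat_one_div_lt (abs_pos.mpr hx0)
      exact ⟨n, Or.inr hn.le⟩

/-- A Jordan decomposition of the difference of two `σ`-finite measures. -/
theorem exists_mutuallySingular_add_eq_add {α : Type*} [MeasurableSpace α] (μ ν : Measure α)
    [SigmaFinite μ] [SigmaFinite ν] :
    ∃ μ' ν' : Measure α, μ' ≤ μ ∧ ν' ≤ ν ∧ μ' ⟂ₘ ν' ∧ μ' + ν = ν' + μ := by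
  let f := μ.rnDeriv (μ + ν)
  let g := ν.rnDeriv (μ + ν)
  have hfm : Measurable f := Measure.measurable_rnDeriv _ _
  have hgm : Measurable g := Measure.measurable_rnDeriv _ _
  have hμ : (μ + ν).withDensity f = μ := Measure.withDensity_rnDeriv_eq _ _
    (Measure.le_add_right le_rfl).absolutelyContinuous
  have hν : (μ + ν).withDensity g = ν := Measure.withDensity_rnDeriv_eq _ _
    (Measure.le_add_left le_rfl).absolutelyContinuous
  refine ⟨(μ + ν).withDensity (f - g), (μ + ν).withDensity (g - f), ?_, ?_, ?_, ?_⟩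
  · exact (withDensity_mono (.of_forall fun x ↦ tsub_le_self)).trans hμ.le
  · exact (withDensity_mono (.of_forall fun x ↦ tsub_le_self)).trans hν.le
  · refine ⟨{x | f x ≤ g x}, measurableSet_le hfm hgm, ?_, ?_⟩
    · rw [withDensity_apply _ (measurableSet_le hfm hgm)]
      exact setLIntegral_eq_zero (measurableSet_le hfm hgm) fun x hx ↦ tsub_eq_zero_of_le hx
    · rw [withDensity_apply _ (measurableSet_le hfm hgm).compl]
      exact setLIntegral_eq_zero (measurableSet_le hfm hgm).compl
        fun x hx ↦ tsub_eq_zero_of_le (le_of_not_ge hx)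
  · calc (μ + ν).withDensity (f - g) + ν
        = (μ + ν).withDensity (f - g + g) := by rw [withDensity_add_right _ hgm, hν]
      _ = (μ + ν).withDensity (g - f + f) := by
        congr 1
        ext x
        simp only [Pi.add_apply, Pi.sub_apply, tsub_add_eq_max, max_comm]
      _ = (μ + ν).withDensity (g - f) + μ := by rw [withDensity_add_right _ hfm, hμ]

/-- The positive part of a difference of Lévy measures is minimal. -/
theorem le_of_mutuallySingular_of_sub_eq_sub {μ ν μ' ν' : Measure ℝ} (hμ : IsLevyMeasure μ)
    (hμ' : IsLevyMeasure μ') (hs : μ ⟂ₘ ν)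
    (h : ∀ B : Set ℝ, MeasurableSet B → BoundedAwayFromZero B →
      (μ B).toReal - (ν B).toReal = (μ' B).toReal - (ν' B).toReal) : μ ≤ μ' := by
  refine measure_le_of_forall_boundedAwayFromZero hμ.1 fun B hB hB0 ↦ ?_
  obtain ⟨S, hS, hμS, hνS⟩ := hs
  have hBS : BoundedAwayFromZero (B ∩ Sᶜ) := by
    obtain ⟨r, hr, hBr⟩ := hB0
    exact ⟨r, hr, subset_empty_iff.mp (hBr ▸ inter_subset_inter_left _ inter_subset_left)⟩
  have hle : μ (B ∩ Sᶜ) ≤ μ' (B ∩ Sᶜ) := by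
    rw [← ENNReal.toReal_le_toReal (hμ.measure_lt_top hBS).ne (hμ'.measure_lt_top hBS).ne]
    have hν0 : ν (B ∩ Sᶜ) = 0 := measure_mono_null inter_subset_right hνS
    have := h _ (hB.inter hS.compl) hBS
    rw [hν0, ENNReal.toReal_zero, sub_zero] at this
    linarith [ENNReal.toReal_nonneg (a := ν' (B ∩ Sᶜ))]
  calc μ B ≤ μ (S ∪ B ∩ Sᶜ) := measure_mono fun x hx ↦ by
        by_cases hxS : x ∈ S
        · exact Or.inl hxS
        · exact Or.inr ⟨hx, hxS⟩
    _ ≤ μ S + μ (B ∩ Sᶜ) := measure_union_le _ _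
    _ ≤ μ' B := by
      rw [hμS, zero_add]
      exact hle.trans (measure_mono inter_subset_left)

/-- Given two Lévy measures `ν₁`, `ν₂` on `ℝ`, there exists a unique pair `(ν⁺, ν⁻)` of
mutually singular Lévy measures with `ν⁺(B) − ν⁻(B) = ν₁(B) − ν₂(B)` for every Borel set
`B` bounded away from zero. -/
theorem exists_unique_levy_pair (ν₁ ν₂ : Measure ℝ)
    (h₁ : IsLevyMeasure ν₁) (h₂ : IsLevyMeasure ν₂) :
    ∃! p : Measure ℝ × Measure ℝ,
      IsLevyMeasure p.1 ∧ IsLevyMeasure p.2 ∧ p.1 ⟂ₘ p.2 ∧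
      ∀ B : Set ℝ, MeasurableSet B → BoundedAwayFromZero B →
        (p.1 B).toReal - (p.2 B).toReal = (ν₁ B).toReal - (ν₂ B).toReal := by
  have := h₁.sigmaFinite
  have := h₂.sigmaFinite
  obtain ⟨μ, ν, hμ, hν, hs, hadd⟩ := exists_mutuallySingular_add_eq_add ν₁ ν₂
  have hμL := h₁.mono hμ
  have hνL := h₂.mono hν
  have hsub (B : Set ℝ) (hB0 : BoundedAwayFromZero B) :
      (μ B).toReal - (ν B).toReal = (ν₁ B).toReal - (ν₂ B).toReal := by
    have hB := congrArg (fun m : Measure ℝ ↦ (m B).toReal) hadd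
    simp only [Measure.add_apply] at hB
    rw [ENNReal.toReal_add (hμL.measure_lt_top hB0).ne (h₂.measure_lt_top hB0).ne,
      ENNReal.toReal_add (hνL.measure_lt_top hB0).ne (h₁.measure_lt_top hB0).ne] at hB
    linarith
  refine ⟨(μ, ν), ⟨hμL, hνL, hs, fun B _ hB0 ↦ hsub B hB0⟩, ?_⟩
  rintro ⟨μ', ν'⟩ ⟨hμL', hνL', hs', h'⟩
  refine Prod.ext (le_antisymm ?_ ?_) (le_antisymm ?_ ?_)
  · exact le_of_mutuallySingular_of_sub_eq_sub hμL' hμL hs'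
      fun B hB hB0 ↦ (h' B hB hB0).trans (hsub B hB0).symm
  · exact le_of_mutuallySingular_of_sub_eq_sub hμL hμL' hs
      fun B hB hB0 ↦ (hsub B hB0).trans (h' B hB hB0).symm
  · exact le_of_mutuallySingular_of_sub_eq_sub (ν := μ') (ν' := μ) hνL' hνL hs'.symm
      fun B hB hB0 ↦ by linarith [h' B hB hB0, hsub B hB0]
  · exact le_of_mutuallySingular_of_sub_eq_sub (ν := μ) (ν' := μ') hνL hνL' hs.symm
      fun B hB hB0 ↦ by linarith [h' B hB hB0, hsub B hB0]
end

section
/- For every Borel set B ⊆ ℝ, the maps s ↦ μ_s⁺(B) and s ↦ μ_s⁻(B) are 𝒮-measurable. -/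
open MeasureTheory

/-- The positive part of the Jordan decomposition of the difference `μ − ν` of two finite
measures on `ℝ`. -/
noncomputable def jordanPosOf (μ ν : Measure ℝ) (hμ : IsFiniteMeasure μ)
    (hν : IsFiniteMeasure ν) : Measure ℝ :=
  ((@Measure.toSignedMeasure ℝ _ μ hμ) -
    (@Measure.toSignedMeasure ℝ _ ν hν)).toJordanDecomposition.posPart

/-- The negative part of the Jordan decomposition of the difference `μ − ν` of two finite
measures on `ℝ`. -/
noncomputable def jordanNegOf (μ ν : Measure ℝ) (hμ : IsFiniteMeasure μ)
    (hν : IsFiniteMeasure ν) : Measure ℝ :=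
  ((@Measure.toSignedMeasure ℝ _ μ hμ) -
    (@Measure.toSignedMeasure ℝ _ ν hν)).toJordanDecomposition.negPart

open ProbabilityTheory in
/-- Two measurable families of finite measures with values in a countably generated space admit
Hahn decompositions that depend jointly measurably on the parameter. -/
theorem exists_measurableSet_isHahnDecomposition {α γ : Type*} [MeasurableSpace α]
    [MeasurableSpace γ] [MeasurableSpace.CountableOrCountablyGenerated α γ]
    (κ η : Kernel α γ) (hκ : ∀ a, IsFiniteMeasure (κ a)) (hη : ∀ a, IsFiniteMeasure (η a)) :
    ∃ t : Set (α × γ), MeasurableSet t ∧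
      ∀ a, IsHahnDecomposition (κ a) (η a) (Prod.mk a ⁻¹' t) := by
  set c : α → ENNReal := fun a => (1 + κ a Set.univ + η a Set.univ)⁻¹ with hc
  have hcm : Measurable c :=
    ((measurable_const.add (κ.measurable_coe .univ)).add (η.measurable_coe .univ)).inv
  have hc0 : ∀ a, c a ≠ 0 := fun a => by simp [hc]
  have hctop : ∀ a, c a ≠ ⊤ := fun a => by simp [hc]
  have hscale : ∀ ξ : Kernel α γ, Measurable fun a => c a • ξ a := fun ξ =>
    Measure.measurable_of_measurable_coe _ fun B hB => by
      simp only [Measure.smul_apply, smul_eq_mul]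
      exact hcm.mul (ξ.measurable_coe hB)
  let κ' : Kernel α γ := ⟨fun a => c a • κ a, hscale κ⟩
  let η' : Kernel α γ := ⟨fun a => c a • η a, hscale η⟩
  have hκ' : ∀ a, κ' a = c a • κ a := fun _ => rfl
  have hη' : ∀ a, η' a = c a • η a := fun _ => rfl
  have bound : ∀ a (x : ENNReal), x ≤ 1 + κ a Set.univ + η a Set.univ → c a * x ≤ 1 :=
    fun a x hx => (mul_le_mul_right hx _).trans (ENNReal.inv_mul_le_one _)
  have : IsFiniteKernel κ' := ⟨1, ENNReal.one_lt_top, fun a => by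
    simpa [hκ'] using bound a _ (le_add_right le_add_self)⟩
  have : IsFiniteKernel η' := ⟨1, ENNReal.one_lt_top, fun a => by
    simpa [hη'] using bound a _ le_add_self⟩
  set f := κ'.rnDeriv (κ' + η')
  set g := η'.rnDeriv (κ' + η')
  have hf : Measurable (Function.uncurry f) := κ'.measurable_rnDeriv _
  have hg : Measurable (Function.uncurry g) := η'.measurable_rnDeriv _
  have hfd : ∀ a, ((κ' + η') a).withDensity (f a) = κ' a := fun a => by
    rw [← Kernel.withDensity_apply _ hf]
    exact Kernel.withDensity_rnDeriv_eq
      (Measure.absolutelyContinuous_of_le (Measure.le_add_right le_rfl))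
  have hgd : ∀ a, ((κ' + η') a).withDensity (g a) = η' a := fun a => by
    rw [← Kernel.withDensity_apply _ hg]
    exact Kernel.withDensity_rnDeriv_eq
      (Measure.absolutelyContinuous_of_le (Measure.le_add_left le_rfl))
  have unscale : ∀ a (μ ν : Measure γ), c a • μ ≤ c a • ν → μ ≤ ν := fun a μ ν h B => by
    have := h B
    simp only [Measure.smul_apply, smul_eq_mul] at this
    exact (ENNReal.mul_le_mul_iff_right (hc0 a) (hctop a)).1 this
  have ht : MeasurableSet {p : α × γ | Function.uncurry f p ≤ Function.uncurry g p} :=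
    measurableSet_le hf hg
  refine ⟨_, ht, fun a => ?_⟩
  have hta := measurable_prodMk_left (x := a) ht
  refine ⟨hta, unscale a _ _ ?_, unscale a _ _ ?_⟩
  · rw [← Measure.restrict_smul, ← Measure.restrict_smul, ← hκ', ← hη', ← hfd, ← hgd,
      restrict_withDensity hta, restrict_withDensity hta]
    refine withDensity_mono ?_
    filter_upwards [ae_restrict_mem hta] with x hx using hx
  · rw [← Measure.restrict_smul, ← Measure.restrict_smul, ← hκ', ← hη', ← hfd, ← hgd,
      restrict_withDensity hta.compl, restrict_withDensity hta.compl]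
    refine withDensity_mono ?_
    filter_upwards [ae_restrict_mem hta.compl] with x hx using le_of_not_ge hx

theorem MeasureTheory.IsHahnDecomposition.sub_apply {γ : Type*} [MeasurableSpace γ]
    {μ ν : Measure γ} [IsFiniteMeasure μ] {t : Set γ} (h : IsHahnDecomposition μ ν t)
    {B : Set γ} (hB : MeasurableSet B) : (ν - μ) B = ν (B ∩ t) - μ (B ∩ t) := by
  have hcompl : (ν - μ) (B ∩ tᶜ) = 0 :=
    measure_mono_null Set.inter_subset_right
      (Measure.sub_apply_eq_zero_of_isHahnDecomposition h.compl)
  rw [← measure_inter_add_sdiff B h.measurableSet, Set.sdiff_eq, hcompl, add_zero,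
    ← Measure.restrict_apply hB, Measure.restrict_sub_eq_restrict_sub_restrict h.measurableSet,
    Measure.sub_apply hB h.le_on, Measure.restrict_apply hB, Measure.restrict_apply hB]

open ProbabilityTheory in
theorem measurable_kernel_sub_apply {α γ : Type*} [MeasurableSpace α]
    [MeasurableSpace γ] [MeasurableSpace.CountableOrCountablyGenerated α γ]
    (κ η : Kernel α γ) (hκ : ∀ a, IsFiniteMeasure (κ a)) (hη : ∀ a, IsFiniteMeasure (η a))
    {B : Set γ} (hB : MeasurableSet B) : Measurable fun a => (κ a - η a) B := by
  obtain ⟨t, ht, h⟩ := exists_measurableSet_isHahnDecomposition η κ hη hκ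
  simp_rw [fun a => (h a).sub_apply hB]
  have hBt : MeasurableSet (Prod.snd ⁻¹' B ∩ t) := (measurable_snd hB).inter ht
  exact (Kernel.measurable_kernel_prodMk_left_of_finite hBt hκ).sub
    (Kernel.measurable_kernel_prodMk_left_of_finite hBt hη)

/-- If `κ₁, κ₂` assign to each `s ∈ S` a finite Borel measure on `ℝ`, measurably in `s`,
and `μ_s = κ₁(s) − κ₂(s)` has Jordan decomposition `μ_s = μ_s⁺ − μ_s⁻`, then for every
Borel set `B` the maps `s ↦ μ_s⁺(B)` and `s ↦ μ_s⁻(B)` are measurable. -/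
theorem measurable_jordan_parts {S : Type*} [MeasurableSpace S]
    (κ₁ κ₂ : S → Measure ℝ)
    (hfin₁ : ∀ s, IsFiniteMeasure (κ₁ s)) (hfin₂ : ∀ s, IsFiniteMeasure (κ₂ s))
    (hmeas₁ : ∀ B : Set ℝ, MeasurableSet B → Measurable fun s => κ₁ s B)
    (hmeas₂ : ∀ B : Set ℝ, MeasurableSet B → Measurable fun s => κ₂ s B) :
    ∀ B : Set ℝ, MeasurableSet B →
      Measurable (fun s => jordanPosOf (κ₁ s) (κ₂ s) (hfin₁ s) (hfin₂ s) B) ∧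
      Measurable (fun s => jordanNegOf (κ₁ s) (κ₂ s) (hfin₁ s) (hfin₂ s) B) := by
  intro B hB
  let K₁ : ProbabilityTheory.Kernel S ℝ := ⟨κ₁, Measure.measurable_of_measurable_coe _ hmeas₁⟩
  let K₂ : ProbabilityTheory.Kernel S ℝ := ⟨κ₂, Measure.measurable_of_measurable_coe _ hmeas₂⟩
  simp only [jordanPosOf, jordanNegOf, Measure.toJordanDecomposition_toSignedMeasure_sub,
    Measure.jordanDecompositionOfToSignedMeasureSub_posPart,
    Measure.jordanDecompositionOfToSignedMeasureSub_negPart]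
  exact ⟨measurable_kernel_sub_apply K₁ K₂ hfin₁ hfin₂ hB,
    measurable_kernel_sub_apply K₂ K₁ hfin₂ hfin₁ hB⟩
end

section
/- Let additionally λ be a measure on (S, 𝒮) with ∫_S κᵢ(s)(ℝ) λ(ds) < ∞ for i = 1, 2, and define the finite signed measure F on the Borel σ-algebra of ℝ by F(B) = ∫_S μ_s(B) λ(ds), with Jordan decomposition F = F⁺ − F⁻. Then for every Borel set B ⊆ ℝ: F⁺(B) ≤ ∫_S μ_s⁺(B) λ(ds) and F⁻(B) ≤ ∫_S μ_s⁻(B) λ(ds). -/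
open MeasureTheory

theorem ofReal_integral_le_lintegral_ofReal {S : Type*} [MeasurableSpace S] (μ : Measure S)
    (f : S → ℝ) : ENNReal.ofReal (∫ s, f s ∂μ) ≤ ∫⁻ s, ENNReal.ofReal (f s) ∂μ := by
  by_cases hf : Integrable f μ
  · rw [integral_eq_lintegral_pos_part_sub_lintegral_neg_part hf]
    exact (ENNReal.ofReal_le_ofReal (sub_le_self _ ENNReal.toReal_nonneg)).trans
      ENNReal.ofReal_toReal_le
  · simp [integral_undef hf]

theorem MeasureTheory.SignedMeasure.ofReal_apply_le_posPart {α : Type*} [MeasurableSpace α]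
    (G : SignedMeasure α) {A : Set α} (hA : MeasurableSet A) :
    ENNReal.ofReal (G A) ≤ G.toJordanDecomposition.posPart A := by
  rw [G.apply_eq_posPart_real_sub_negPart_real hA]
  exact (ENNReal.ofReal_le_ofReal (sub_le_self _ measureReal_nonneg)).trans
    ENNReal.ofReal_toReal_le

theorem MeasureTheory.SignedMeasure.exists_posPart_eq_ofReal_inter {α : Type*}
    [MeasurableSpace α] (G : SignedMeasure α) :
    ∃ P, MeasurableSet P ∧ ∀ B, MeasurableSet B →
      G.toJordanDecomposition.posPart B = ENNReal.ofReal (G (P ∩ B)) := by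
  obtain ⟨P, hP, hpos, -, h, -⟩ := G.toJordanDecomposition_spec
  refine ⟨P, hP, fun B hB => ?_⟩
  rw [h, ← G.toMeasureOfZeroLE_real_apply hpos hP hB, ofReal_measureReal]

/-- The positive part of a mixture of signed measures is at most the mixture of the positive
parts. -/
theorem MeasureTheory.SignedMeasure.posPart_le_lintegral_posPart {S α : Type*}
    [MeasurableSpace S] [MeasurableSpace α] (μ : Measure S) (G : S → SignedMeasure α)
    (F : SignedMeasure α) (hF : ∀ B, MeasurableSet B → F B = ∫ s, G s B ∂μ)
    {B : Set α} (hB : MeasurableSet B) :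
    F.toJordanDecomposition.posPart B
      ≤ ∫⁻ s, (G s).toJordanDecomposition.posPart B ∂μ := by
  obtain ⟨P, hP, h⟩ := F.exists_posPart_eq_ofReal_inter
  rw [h B hB, hF _ (hP.inter hB)]
  refine (ofReal_integral_le_lintegral_ofReal μ _).trans (lintegral_mono fun s => ?_)
  exact ((G s).ofReal_apply_le_posPart (hP.inter hB)).trans (measure_mono Set.inter_subset_right)

/-- The negative part of a mixture of signed measures is at most the mixture of the negative
parts. -/
theorem MeasureTheory.SignedMeasure.negPart_le_lintegral_negPart {S α : Type*}
    [MeasurableSpace S] [MeasurableSpace α] (μ : Measure S) (G : S → SignedMeasure α)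
    (F : SignedMeasure α) (hF : ∀ B, MeasurableSet B → F B = ∫ s, G s B ∂μ)
    {B : Set α} (hB : MeasurableSet B) :
    F.toJordanDecomposition.negPart B
      ≤ ∫⁻ s, (G s).toJordanDecomposition.negPart B ∂μ := by
  have h := posPart_le_lintegral_posPart μ (fun s => -G s) (-F)
    (fun A hA => by simp [hF A hA, integral_neg]) hB
  simpa only [toJordanDecomposition_neg, JordanDecomposition.neg_posPart] using h

/-- Let `μ_s = κ₁(s) − κ₂(s)` with Jordan decomposition `μ_s⁺ − μ_s⁻`, and let `λ` be a
measure on `S` with `∫ κᵢ(s)(ℝ) λ(ds) < ∞`. If `F` is the finite signed measure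
`F(B) = ∫ μ_s(B) λ(ds)`, with Jordan decomposition `F = F⁺ − F⁻`, then
`F⁺(B) ≤ ∫ μ_s⁺(B) λ(ds)` and `F⁻(B) ≤ ∫ μ_s⁻(B) λ(ds)` for every Borel set `B`. -/
theorem jordan_parts_le_integral {S : Type*} [MeasurableSpace S]
    (κ₁ κ₂ : S → Measure ℝ)
    (hfin₁ : ∀ s, IsFiniteMeasure (κ₁ s)) (hfin₂ : ∀ s, IsFiniteMeasure (κ₂ s))
    (hmeas₁ : ∀ B : Set ℝ, MeasurableSet B → Measurable fun s => κ₁ s B)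
    (hmeas₂ : ∀ B : Set ℝ, MeasurableSet B → Measurable fun s => κ₂ s B)
    (lam : Measure S)
    (hint₁ : ∫⁻ s, κ₁ s Set.univ ∂lam < ⊤) (hint₂ : ∫⁻ s, κ₂ s Set.univ ∂lam < ⊤)
    (F : SignedMeasure ℝ)
    (hF : ∀ B : Set ℝ, MeasurableSet B →
      F B = ∫ s, ((κ₁ s B).toReal - (κ₂ s B).toReal) ∂lam) :
    ∀ B : Set ℝ, MeasurableSet B →
      F.toJordanDecomposition.posPart B
          ≤ ∫⁻ s, jordanPosOf (κ₁ s) (κ₂ s) (hfin₁ s) (hfin₂ s) B ∂lam ∧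
      F.toJordanDecomposition.negPart B
          ≤ ∫⁻ s, jordanNegOf (κ₁ s) (κ₂ s) (hfin₁ s) (hfin₂ s) B ∂lam := by
  have hG : ∀ B : Set ℝ, MeasurableSet B → F B = ∫ s,
      (@Measure.toSignedMeasure ℝ _ (κ₁ s) (hfin₁ s) -
        @Measure.toSignedMeasure ℝ _ (κ₂ s) (hfin₂ s)) B ∂lam := fun B hB => by
    simp only [hF B hB, Measure.toSignedMeasure_sub_apply hB, measureReal_def]
  exact fun B hB => ⟨SignedMeasure.posPart_le_lintegral_posPart lam _ F hG hB,
    SignedMeasure.negPart_le_lintegral_negPart lam _ F hG hB⟩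
end

section
/- Let additionally λ be a measure on (S, 𝒮) with ∫_S κᵢ(s)(ℝ) λ(ds) < ∞ for i = 1, 2. Define measures P and N on the product σ-algebra 𝒮 ⊗ ℬ(ℝ) by P(C) = ∫_S μ_s⁺(C_s) λ(ds) and N(C) = ∫_S μ_s⁻(C_s) λ(ds), where C_s = {x ∈ ℝ : (s, x) ∈ C} denotes the section of C at s. Then P and N are mutually singular; consequently, (P, N) is the Jordan decomposition of the finite signed measure C ↦ P(C) − N(C) on 𝒮 ⊗ ℬ(ℝ). -/
open MeasureTheory

open ProbabilityTheory

/-- Two finite kernels into a countably generated space admit a jointly measurable family of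
Hahn decompositions. -/
theorem exists_isHahnDecomposition_sections_of_isFiniteKernel {α γ : Type*} [MeasurableSpace α]
    [MeasurableSpace γ] [MeasurableSpace.CountableOrCountablyGenerated α γ] (κ η : Kernel α γ)
    [IsFiniteKernel κ] [IsFiniteKernel η] :
    ∃ A : Set (α × γ), MeasurableSet A ∧
      ∀ a, IsHahnDecomposition (κ a) (η a) (Prod.mk a ⁻¹' A) := by
  let f : α → γ → ℝ := Kernel.rnDerivAux κ (κ + η)
  let g : α → γ → ℝ := Kernel.rnDerivAux η (η + κ)
  have hf (a : α) {s : Set γ} (hs : MeasurableSet s) :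
      ∫⁻ x in s, ENNReal.ofReal (f a x) ∂(κ + η) a = κ a s :=
    Kernel.setLIntegral_rnDerivAux κ η a hs
  have hg (a : α) {s : Set γ} (hs : MeasurableSet s) :
      ∫⁻ x in s, ENNReal.ofReal (g a x) ∂(κ + η) a = η a s := by
    rw [add_comm κ η]
    exact Kernel.setLIntegral_rnDerivAux η κ a hs
  have hA : MeasurableSet {p : α × γ | f p.1 p.2 ≤ g p.1 p.2} :=
    measurableSet_le (Kernel.measurable_rnDerivAux κ (κ + η))
      (Kernel.measurable_rnDerivAux η (η + κ))
  refine ⟨_, hA, fun a => ?_⟩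
  have hAa := measurable_prodMk_left (x := a) hA
  refine ⟨hAa, ?_, ?_⟩
  · rw [Measure.le_iff]
    intro t ht
    rw [Measure.restrict_apply ht, Measure.restrict_apply ht, ← hf a (ht.inter hAa),
      ← hg a (ht.inter hAa)]
    exact setLIntegral_mono' (ht.inter hAa) fun x hx => ENNReal.ofReal_le_ofReal hx.2
  · rw [Measure.le_iff]
    intro t ht
    rw [Measure.restrict_apply ht, Measure.restrict_apply ht, ← hf a (ht.inter hAa.compl),
      ← hg a (ht.inter hAa.compl)]
    exact setLIntegral_mono' (ht.inter hAa.compl) fun x hx =>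
      ENNReal.ofReal_le_ofReal ((le_total (f a x) (g a x)).resolve_left hx.2)

theorem isHahnDecomposition_of_smul {γ : Type*} [MeasurableSpace γ] {μ ν : Measure γ}
    {c : ENNReal} (hc₀ : c ≠ 0) (hc : c ≠ ⊤) {s : Set γ}
    (h : IsHahnDecomposition (c • μ) (c • ν) s) : IsHahnDecomposition μ ν s where
  measurableSet := h.measurableSet
  le_on := Measure.le_iff'.2 fun t => by
    simpa [ENNReal.mul_le_mul_iff_right hc₀ hc] using h.le_on t
  ge_on_compl := Measure.le_iff'.2 fun t => by
    simpa [ENNReal.mul_le_mul_iff_right hc₀ hc] using h.ge_on_compl t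

/-- Two measurable families of finite measures, not necessarily uniformly bounded, admit a jointly
measurable family of Hahn decompositions. -/
theorem exists_isHahnDecomposition_sections {α γ : Type*} [MeasurableSpace α]
    [MeasurableSpace γ] [MeasurableSpace.CountableOrCountablyGenerated α γ] (κ η : Kernel α γ)
    [∀ a, IsFiniteMeasure (κ a)] [∀ a, IsFiniteMeasure (η a)] :
    ∃ A : Set (α × γ), MeasurableSet A ∧
      ∀ a, IsHahnDecomposition (κ a) (η a) (Prod.mk a ⁻¹' A) := by
  let m : α → ENNReal := fun a => 1 + (κ a Set.univ + η a Set.univ)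
  have hm₀ (a : α) : m a ≠ 0 := by simp [m]
  have hm (a : α) : m a ≠ ⊤ := by simp [m]
  have hm_meas : Measurable fun a => (m a)⁻¹ :=
    (measurable_const.add ((κ.measurable_coe MeasurableSet.univ).add
      (η.measurable_coe MeasurableSet.univ))).inv
  let normalize (ξ : Kernel α γ) : Kernel α γ :=
    { toFun := fun a => (m a)⁻¹ • ξ a
      measurable' := Measure.measurable_of_measurable_coe _ fun s hs => by
        exact hm_meas.mul (ξ.measurable_coe hs) }
  have normalize_finite (ξ : Kernel α γ) (h : ∀ a, ξ a Set.univ ≤ m a) :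
      IsFiniteKernel (normalize ξ) := by
    refine ⟨1, ENNReal.one_lt_top, fun a => ?_⟩
    change (m a)⁻¹ * ξ a Set.univ ≤ 1
    calc (m a)⁻¹ * ξ a Set.univ ≤ (m a)⁻¹ * m a := by gcongr; exact h a
      _ = 1 := ENNReal.inv_mul_cancel (hm₀ a) (hm a)
  have := normalize_finite κ fun a => le_self_add.trans le_add_self
  have := normalize_finite η fun a => le_add_self.trans le_add_self
  obtain ⟨A, hA, h⟩ :=
    exists_isHahnDecomposition_sections_of_isFiniteKernel (normalize κ) (normalize η)
  exact ⟨A, hA, fun a => isHahnDecomposition_of_smul (ENNReal.inv_ne_zero.2 (hm a))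
    (ENNReal.inv_ne_top.2 (hm₀ a)) (h a)⟩

theorem jordanPosOf_eq_sub (μ ν : Measure ℝ) (hμ : IsFiniteMeasure μ) (hν : IsFiniteMeasure ν) :
    jordanPosOf μ ν hμ hν = μ - ν := by
  rw [jordanPosOf, Measure.toJordanDecomposition_toSignedMeasure_sub,
    Measure.jordanDecompositionOfToSignedMeasureSub_posPart]

theorem jordanNegOf_eq_sub (μ ν : Measure ℝ) (hμ : IsFiniteMeasure μ) (hν : IsFiniteMeasure ν) :
    jordanNegOf μ ν hμ hν = ν - μ := by
  rw [jordanNegOf, Measure.toJordanDecomposition_toSignedMeasure_sub,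
    Measure.jordanDecompositionOfToSignedMeasureSub_negPart]

theorem toJordanDecomposition_sub_of_mutuallySingular {α : Type*} [MeasurableSpace α]
    {μ ν : Measure α} [IsFiniteMeasure μ] [IsFiniteMeasure ν] (h : μ ⟂ₘ ν) :
    (μ.toSignedMeasure - ν.toSignedMeasure).toJordanDecomposition =
      { posPart := μ, negPart := ν, mutuallySingular := h } :=
  SignedMeasure.toJordanDecomposition_eq rfl

/-- Let `μ_s = κ₁(s) − κ₂(s)` with Jordan decomposition `μ_s⁺ − μ_s⁻`, and let `λ` be a
measure on `S` with `∫ κᵢ(s)(ℝ) λ(ds) < ∞`. If `P` and `N` are the measures on the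
product σ-algebra given by `P(C) = ∫ μ_s⁺(C_s) λ(ds)` and `N(C) = ∫ μ_s⁻(C_s) λ(ds)`
(where `C_s` is the section of `C` at `s`), then `P` and `N` are mutually singular;
consequently `(P, N)` is the Jordan decomposition of the finite signed measure
`P − N` on `𝒮 ⊗ ℬ(ℝ)`. -/
theorem mutuallySingular_sections {S : Type*} [MeasurableSpace S]
    (κ₁ κ₂ : S → Measure ℝ)
    (hfin₁ : ∀ s, IsFiniteMeasure (κ₁ s)) (hfin₂ : ∀ s, IsFiniteMeasure (κ₂ s))
    (hmeas₁ : ∀ B : Set ℝ, MeasurableSet B → Measurable fun s => κ₁ s B)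
    (hmeas₂ : ∀ B : Set ℝ, MeasurableSet B → Measurable fun s => κ₂ s B)
    (lam : Measure S)
    (hint₁ : ∫⁻ s, κ₁ s Set.univ ∂lam < ⊤) (hint₂ : ∫⁻ s, κ₂ s Set.univ ∂lam < ⊤)
    (P N : Measure (S × ℝ))
    (hP : ∀ C : Set (S × ℝ), MeasurableSet C →
      P C = ∫⁻ s, jordanPosOf (κ₁ s) (κ₂ s) (hfin₁ s) (hfin₂ s) (Prod.mk s ⁻¹' C) ∂lam)
    (hN : ∀ C : Set (S × ℝ), MeasurableSet C →
      N C = ∫⁻ s, jordanNegOf (κ₁ s) (κ₂ s) (hfin₁ s) (hfin₂ s) (Prod.mk s ⁻¹' C) ∂lam) :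
    P ⟂ₘ N ∧
    ∀ (hPf : IsFiniteMeasure P) (hNf : IsFiniteMeasure N),
      ((@Measure.toSignedMeasure (S × ℝ) _ P hPf) -
        (@Measure.toSignedMeasure (S × ℝ) _ N hNf)).toJordanDecomposition.posPart = P ∧
      ((@Measure.toSignedMeasure (S × ℝ) _ P hPf) -
        (@Measure.toSignedMeasure (S × ℝ) _ N hNf)).toJordanDecomposition.negPart = N := by
  let η₁ : Kernel S ℝ := ⟨κ₁, Measure.measurable_of_measurable_coe _ hmeas₁⟩
  let η₂ : Kernel S ℝ := ⟨κ₂, Measure.measurable_of_measurable_coe _ hmeas₂⟩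
  have : ∀ s, IsFiniteMeasure (η₁ s) := hfin₁
  have : ∀ s, IsFiniteMeasure (η₂ s) := hfin₂
  obtain ⟨A, hA, hHahn⟩ := exists_isHahnDecomposition_sections η₁ η₂
  have hPN : P ⟂ₘ N := by
    refine ⟨A, hA, ?_, ?_⟩
    · rw [hP A hA]
      simp_rw [jordanPosOf_eq_sub]
      exact lintegral_eq_zero_of_ae_eq_zero <| .of_forall fun s =>
        Measure.sub_apply_eq_zero_of_isHahnDecomposition (hHahn s)
    · rw [hN Aᶜ hA.compl]
      simp_rw [jordanNegOf_eq_sub]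
      exact lintegral_eq_zero_of_ae_eq_zero <| .of_forall fun s =>
        Measure.sub_apply_eq_zero_of_isHahnDecomposition (hHahn s).compl
  refine ⟨hPN, fun hPf hNf => ?_⟩
  rw [toJordanDecomposition_sub_of_mutuallySingular hPN]
  exact ⟨rfl, rfl⟩
end

section
/- Let (X, ℬ) be a standard Borel space and (T, 𝒜) an arbitrary measurable space. Let Q₀(A, B), defined for A ∈ 𝒜 and B ∈ ℬ, be a real-valued function satisfying: (a) for every A ∈ 𝒜, the map B ↦ Q₀(A, B) is a finite signed measure on (X, ℬ); (b) for every B ∈ ℬ, the map A ↦ Q₀(A, B) is a finite signed measure on (T, 𝒜); (c) sup_I Σ_{i∈I} |Q₀(A_i, B_i)| < ∞, where the supremum runs over all finite families ((A_i, B_i))_{i∈I} of pairs of measurable sets such that the rectangles A_i × B_i are pairwise disjoint. For A ∈ 𝒜, set ν(A) := sup Σ_{i∈I} |Q₀(A_i, B_i)|, the supremum over such finite families with additionally A_i ⊆ A for all i. Then: (1) ν is a finite measure on (T, 𝒜); (2) there exists a unique finite signed measure Q on the product σ-algebra 𝒜 ⊗ ℬ with Q(A × B) = Q₀(A, B) for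 all A ∈ 𝒜, B ∈ ℬ; (3) there exists a function q : T × ℬ → [−1, 1] such that q(t, ·) is a signed measure on (X, ℬ) for every t ∈ T, the map t ↦ q(t, B) is 𝒜-measurable for every B ∈ ℬ, and Q₀(A, B) = ∫_A q(t, B) ν(dt) for all A ∈ 𝒜, B ∈ ℬ; (4) q is ν-essentially unique: if q₁ also satisfies the properties in (3), then q₁(t, ·) = q(t, ·) for ν-almost every t ∈ T. -/
open MeasureTheory

/-- A real-valued, countably additive set function on the σ-algebra (i.e., a finite
signed measure described as a set function). -/
def IsCountablyAdditive {α : Type*} [MeasurableSpace α] (m : Set α → ℝ) : Prop :=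
  m ∅ = 0 ∧ ∀ f : ℕ → Set α, (∀ n, MeasurableSet (f n)) →
    Pairwise (Function.onFun Disjoint f) →
    HasSum (fun n => m (f n)) (m (⋃ n, f n))

/-- The set function `ν(A)`: the supremum of `Σ |Q₀(A_i, B_i)|` over finite families of
measurable pairs with pairwise disjoint rectangles `A_i × B_i` and `A_i ⊆ A`. -/
noncomputable def nuOf {T X : Type*} [MeasurableSpace T] [MeasurableSpace X]
    (Q₀ : Set T → Set X → ℝ) (A : Set T) : ℝ :=
  sSup {r : ℝ | ∃ (n : ℕ) (As : Fin n → Set T) (Bs : Fin n → Set X),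
    (∀ i, MeasurableSet (As i)) ∧ (∀ i, As i ⊆ A) ∧ (∀ i, MeasurableSet (Bs i)) ∧
    (Pairwise fun i j => Disjoint (As i ×ˢ Bs i) (As j ×ˢ Bs j)) ∧
    r = ∑ i, |Q₀ (As i) (Bs i)|}


open Set Filter Topology ProbabilityTheory

namespace IsCountablyAdditive

variable {α β : Type*} [MeasurableSpace α] [MeasurableSpace β] {m m' : Set α → ℝ}

/-- A countably additive set function agrees with a signed measure on measurable sets. -/
lemma exists_signedMeasure (h : IsCountablyAdditive m) :
    ∃ v : SignedMeasure α, ∀ s, MeasurableSet s → v s = m s := by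
  classical
  refine ⟨⟨fun s => if MeasurableSet s then m s else 0, by simp [h.1],
    fun s hs => if_neg hs, fun f hf hd => ?_⟩, fun s hs => if_pos hs⟩
  simpa [hf, MeasurableSet.iUnion hf] using h.2 f hf hd

lemma of_signedMeasure (v : SignedMeasure α) : IsCountablyAdditive v :=
  ⟨v.empty, fun _ hf hd => v.hasSum_of_disjoint_iUnion hf hd⟩

lemma union (h : IsCountablyAdditive m) {s t : Set α} (hs : MeasurableSet s)
    (ht : MeasurableSet t) (hd : Disjoint s t) : m (s ∪ t) = m s + m t := by
  obtain ⟨v, hv⟩ := h.exists_signedMeasure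
  rw [← hv _ hs, ← hv _ ht, ← hv _ (hs.union ht), VectorMeasure.of_union hd hs ht]

lemma compl (h : IsCountablyAdditive m) {s : Set α} (hs : MeasurableSet s) :
    m sᶜ = m univ - m s := by
  rw [← union_compl_self s, h.union hs hs.compl disjoint_compl_right, add_sub_cancel_left]

lemma mono (h : IsCountablyAdditive m) (h0 : ∀ s, MeasurableSet s → 0 ≤ m s) {s t : Set α}
    (hs : MeasurableSet s) (ht : MeasurableSet t) (hst : s ⊆ t) : m s ≤ m t := by
  rw [← union_sdiff_cancel hst, h.union hs (ht.diff hs) disjoint_sdiff_right]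
  linarith [h0 _ (ht.diff hs)]

lemma add (h : IsCountablyAdditive m) (h' : IsCountablyAdditive m') :
    IsCountablyAdditive fun s => m s + m' s :=
  ⟨by simp [h.1, h'.1], fun f hf hd => (h.2 f hf hd).add (h'.2 f hf hd)⟩

lemma const_mul (h : IsCountablyAdditive m) (c : ℝ) : IsCountablyAdditive fun s => c * m s :=
  ⟨by simp [h.1], fun f hf hd => (h.2 f hf hd).mul_left c⟩

lemma sub (h : IsCountablyAdditive m) (h' : IsCountablyAdditive m') :
    IsCountablyAdditive fun s => m s - m' s :=
  ⟨by simp [h.1, h'.1], fun f hf hd => (h.2 f hf hd).sub (h'.2 f hf hd)⟩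

lemma preimage {m : Set β → ℝ} (h : IsCountablyAdditive m) {g : β → α} (hg : Measurable g) :
    IsCountablyAdditive fun s => m (g ⁻¹' s) := by
  refine ⟨by simp [h.1], fun f hf hd => ?_⟩
  simp only [preimage_iUnion]
  exact h.2 _ (fun n => hg (hf n)) fun i j hij => (hd hij).preimage g

lemma inter (h : IsCountablyAdditive m) {t : Set α} (ht : MeasurableSet t) :
    IsCountablyAdditive fun s => m (s ∩ t) := by
  refine ⟨by simp [h.1], fun f hf hd => ?_⟩
  simp only [iUnion_inter]
  exact h.2 _ (fun n => (hf n).inter ht) fun i j hij =>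
    (hd hij).mono inter_subset_left inter_subset_left

lemma of_measureReal (μ : Measure α) [IsFiniteMeasure μ] :
    IsCountablyAdditive fun s => μ.real s := by
  refine ⟨by simp, fun f hf hd => ?_⟩
  have := (IsCountablyAdditive.of_signedMeasure μ.toSignedMeasure).2 f hf hd
  simpa [Measure.toSignedMeasure_apply_measurable, hf, MeasurableSet.iUnion hf] using this

/-- Countably additive set functions agreeing on a generating π-system and on the whole space
agree on all measurable sets. -/
lemma ext_of_generateFrom {C : Set (Set α)} (hC : ‹MeasurableSpace α› = .generateFrom C)
    (hpi : IsPiSystem C) (h : IsCountablyAdditive m) (h' : IsCountablyAdditive m')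
    (huniv : m univ = m' univ) (heq : ∀ s ∈ C, m s = m' s) {s : Set α} (hs : MeasurableSet s) :
    m s = m' s := by
  induction s, hs using MeasurableSpace.induction_on_inter hC hpi with
  | empty => rw [h.1, h'.1]
  | basic t ht => exact heq t ht
  | compl t ht ih => rw [h.compl ht, h'.compl ht, huniv, ih]
  | iUnion f hd hf ih =>
    refine (h.2 f hf hd).unique ?_
    simp only [ih]
    exact h'.2 f hf hd

/-- A nonnegative countably additive set function is a finite measure. -/
lemma exists_measure (h : IsCountablyAdditive m) (h0 : ∀ s, MeasurableSet s → 0 ≤ m s) :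
    ∃ μ : Measure α, IsFiniteMeasure μ ∧
      ∀ s, MeasurableSet s → μ s = ENNReal.ofReal (m s) := by
  have key : ∀ s (hs : MeasurableSet s),
      Measure.ofMeasurable (fun s _ => ENNReal.ofReal (m s)) (by simp [h.1])
        (fun f hf hd => by
          rw [← (h.2 f hf hd).tsum_eq]
          exact ENNReal.ofReal_tsum_of_nonneg (fun n => h0 _ (hf n)) (h.2 f hf hd).summable) s
      = ENNReal.ofReal (m s) := fun s hs => Measure.ofMeasurable_apply s hs
  exact ⟨_, ⟨by rw [key _ .univ]; exact ENNReal.ofReal_lt_top⟩, key⟩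

lemma exists_measure_real (h : IsCountablyAdditive m) (h0 : ∀ s, MeasurableSet s → 0 ≤ m s) :
    ∃ μ : Measure α, IsFiniteMeasure μ ∧ ∀ s, MeasurableSet s → μ.real s = m s := by
  obtain ⟨μ, hμ, hm⟩ := h.exists_measure h0
  exact ⟨μ, hμ, fun s hs => by rw [measureReal_def, hm s hs, ENNReal.toReal_ofReal (h0 s hs)]⟩

end IsCountablyAdditive

/-- A function of two measurable sets that is countably additive in each of them. -/
structure IsBimeasure {T X : Type*} [MeasurableSpace T] [MeasurableSpace X]
    (P : Set T → Set X → ℝ) : Prop where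
  right : ∀ A, MeasurableSet A → IsCountablyAdditive (P A)
  left : ∀ B, MeasurableSet B → IsCountablyAdditive fun A => P A B

/-- The sums of `|Q₀|` over finite families of pairwise disjoint measurable rectangles are
bounded. -/
def HasBoundedRectangleVariation {T X : Type*} [MeasurableSpace T] [MeasurableSpace X]
    (Q₀ : Set T → Set X → ℝ) : Prop :=
  ∃ M : ℝ, ∀ (n : ℕ) (As : Fin n → Set T) (Bs : Fin n → Set X),
    (∀ i, MeasurableSet (As i)) → (∀ i, MeasurableSet (Bs i)) →
    (Pairwise fun i j => Disjoint (As i ×ˢ Bs i) (As j ×ˢ Bs j)) →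
    ∑ i, |Q₀ (As i) (Bs i)| ≤ M

section nuOf

lemma disjoint_prod_swap {T X : Type*} {A A' : Set T} {B B' : Set X} :
    Disjoint (B ×ˢ A) (B' ×ˢ A') ↔ Disjoint (A ×ˢ B) (A' ×ˢ B') := by
  rw [Set.disjoint_prod, Set.disjoint_prod, or_comm]

variable {T X : Type*} [MeasurableSpace T] [MeasurableSpace X] {Q₀ : Set T → Set X → ℝ}

lemma sum_le_nuOf (hc : HasBoundedRectangleVariation Q₀) {ι : Type*} [Fintype ι] {A : Set T}
    (As : ι → Set T) (Bs : ι → Set X) (hA : ∀ i, MeasurableSet (As i)) (hAA : ∀ i, As i ⊆ A)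
    (hB : ∀ i, MeasurableSet (Bs i))
    (hd : Pairwise fun i j => Disjoint (As i ×ˢ Bs i) (As j ×ˢ Bs j)) :
    ∑ i, |Q₀ (As i) (Bs i)| ≤ nuOf Q₀ A := by
  obtain ⟨M, hM⟩ := hc
  refine le_csSup ⟨M, ?_⟩ ?_
  · rintro r ⟨n, As, Bs, h1, -, h2, h3, rfl⟩
    exact hM n As Bs h1 h2 h3
  · let e := (Fintype.equivFin ι).symm
    exact ⟨_, As ∘ e, Bs ∘ e, fun i => hA _, fun i => hAA _, fun i => hB _,
      fun i j hij => hd (e.injective.ne hij), (e.sum_comp fun i => |Q₀ (As i) (Bs i)|).symm⟩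

lemma nuOf_le {A : Set T} {c : ℝ}
    (h : ∀ (n : ℕ) (As : Fin n → Set T) (Bs : Fin n → Set X), (∀ i, MeasurableSet (As i)) →
      (∀ i, As i ⊆ A) → (∀ i, MeasurableSet (Bs i)) →
      (Pairwise fun i j => Disjoint (As i ×ˢ Bs i) (As j ×ˢ Bs j)) →
      ∑ i, |Q₀ (As i) (Bs i)| ≤ c) : nuOf Q₀ A ≤ c := by
  refine csSup_le ⟨0, 0, fun _ => ∅, fun _ => ∅, by simp, by simp, by simp, ?_, by simp⟩ ?_
  · exact fun i => i.elim0
  · rintro r ⟨n, As, Bs, h1, h2, h3, h4, rfl⟩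
    exact h n As Bs h1 h2 h3 h4

lemma nuOf_nonneg (hc : HasBoundedRectangleVariation Q₀) (A : Set T) : 0 ≤ nuOf Q₀ A := by
  simpa using sum_le_nuOf (ι := Empty) (A := A) hc (fun _ => ∅) (fun _ => ∅) (by simp) (by simp)
    (by simp) (fun i => i.elim)

lemma nuOf_mono (hc : HasBoundedRectangleVariation Q₀) {A A' : Set T} (h : A ⊆ A') :
    nuOf Q₀ A ≤ nuOf Q₀ A' :=
  nuOf_le fun _ As Bs h1 h2 h3 h4 => sum_le_nuOf hc As Bs h1 (fun i => (h2 i).trans h) h3 h4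

lemma nuOf_add_le_nuOf_union (hc : HasBoundedRectangleVariation Q₀) {A A' : Set T}
    (hd : Disjoint A A') : nuOf Q₀ A + nuOf Q₀ A' ≤ nuOf Q₀ (A ∪ A') := by
  rw [← le_sub_iff_add_le]
  refine nuOf_le fun n As Bs h1 h2 h3 h4 => ?_
  rw [le_sub_comm]
  refine nuOf_le fun n' As' Bs' h1' h2' h3' h4' => ?_
  rw [le_sub_iff_add_le']
  have hdisj : ∀ i j, Disjoint (As i ×ˢ Bs i) (As' j ×ˢ Bs' j) := fun i j =>
    Set.disjoint_prod.2 (Or.inl (hd.mono (h2 i) (h2' j)))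
  have := sum_le_nuOf (A := A ∪ A') hc (Sum.elim As As') (Sum.elim Bs Bs')
    (by rintro (i | i); exacts [h1 i, h1' i])
    (by rintro (i | i)
        exacts [(h2 i).trans subset_union_left, (h2' i).trans subset_union_right])
    (by rintro (i | i); exacts [h3 i, h3' i])
    (by
      rintro (i | i) (j | j) hij
      · exact h4 fun h => hij (congrArg _ h)
      · exact hdisj i j
      · exact (hdisj j i).symm
      · exact h4' fun h => hij (congrArg _ h))
  simpa using this

lemma sum_nuOf_le_nuOf_iUnion (hc : HasBoundedRectangleVariation Q₀) {ι : Type*}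
    {f : ι → Set T} (hd : Pairwise (Function.onFun Disjoint f)) (s : Finset ι) :
    ∑ i ∈ s, nuOf Q₀ (f i) ≤ nuOf Q₀ (⋃ i ∈ s, f i) := by
  classical
  induction s using Finset.induction_on with
  | empty => simpa using nuOf_nonneg hc ∅
  | insert a s ha ih =>
    rw [Finset.sum_insert ha, Finset.set_biUnion_insert]
    refine le_trans (by gcongr) (nuOf_add_le_nuOf_union hc ?_)
    simp only [disjoint_iUnion_right]
    exact fun i hi => hd fun h => ha (h ▸ hi)

/-- The variation of a bimeasure of bounded variation is countably additive. -/
lemma isCountablyAdditive_nuOf (hQ : IsBimeasure Q₀) (hc : HasBoundedRectangleVariation Q₀) :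
    IsCountablyAdditive (nuOf Q₀) := by
  have h0 : nuOf Q₀ ∅ = 0 := by
    refine le_antisymm (nuOf_le fun n As Bs h1 h2 h3 h4 => ?_) (nuOf_nonneg hc _)
    refine (Finset.sum_eq_zero fun i _ => ?_).le
    rw [subset_empty_iff.1 (h2 i), abs_eq_zero]
    exact (hQ.left _ (h3 i)).1
  refine ⟨h0, fun f hf hd => ?_⟩
  have hpart : ∀ s : Finset ℕ, ∑ i ∈ s, nuOf Q₀ (f i) ≤ nuOf Q₀ (⋃ n, f n) := fun s =>
    (sum_nuOf_le_nuOf_iUnion hc hd s).trans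
      (nuOf_mono hc (iUnion₂_subset fun i _ => subset_iUnion f i))
  have hs : Summable fun n => nuOf Q₀ (f n) :=
    summable_of_sum_le (fun n => nuOf_nonneg hc _) hpart
  suffices h : nuOf Q₀ (⋃ n, f n) = ∑' n, nuOf Q₀ (f n) by
    rw [h]
    exact hs.hasSum
  refine le_antisymm (nuOf_le fun n As Bs h1 h2 h3 h4 => ?_) (hs.tsum_le_of_sum_le hpart)
  have hsplit : ∀ i, HasSum (fun k => Q₀ (As i ∩ f k) (Bs i)) (Q₀ (As i) (Bs i)) := fun i => by
    have := (hQ.left _ (h3 i)).2 (fun k => As i ∩ f k) (fun k => (h1 i).inter (hf k))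
      fun k l hkl => (hd hkl).mono inter_subset_right inter_subset_right
    rwa [← inter_iUnion, inter_eq_left.2 (h2 i)] at this
  have habs : ∀ i, Summable fun k => |Q₀ (As i ∩ f k) (Bs i)| := fun i => (hsplit i).summable.abs
  calc ∑ i, |Q₀ (As i) (Bs i)| ≤ ∑ i, ∑' k, |Q₀ (As i ∩ f k) (Bs i)| := by
        refine Finset.sum_le_sum fun i _ => ?_
        rw [← (hsplit i).tsum_eq]
        simpa only [Real.norm_eq_abs] using norm_tsum_le_tsum_norm (hsplit i).summable.norm
    _ = ∑' k, ∑ i, |Q₀ (As i ∩ f k) (Bs i)| :=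
        (Summable.tsum_finsetSum fun i _ => habs i).symm
    _ ≤ ∑' k, nuOf Q₀ (f k) := by
        refine Summable.tsum_le_tsum (fun k => ?_) (summable_sum fun i _ => habs i) hs
        exact sum_le_nuOf hc _ _ (fun i => (h1 i).inter (hf k)) (fun i => inter_subset_right) h3
          fun i j hij => (h4 hij).mono (prod_mono inter_subset_left subset_rfl)
            (prod_mono inter_subset_left subset_rfl)

/-- The variation of `Q₀` over the rectangle `A ×ˢ B`. -/
noncomputable def rectangleVariation (Q₀ : Set T → Set X → ℝ) (A : Set T) (B : Set X) : ℝ :=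
  nuOf (fun A' B' => Q₀ A' (B' ∩ B)) A

lemma rectangleVariation_univ (Q₀ : Set T → Set X → ℝ) (A : Set T) :
    rectangleVariation Q₀ A univ = nuOf Q₀ A := by
  simp [rectangleVariation]

lemma HasBoundedRectangleVariation.inter (hc : HasBoundedRectangleVariation Q₀) {B : Set X}
    (hB : MeasurableSet B) : HasBoundedRectangleVariation fun A' B' => Q₀ A' (B' ∩ B) := by
  obtain ⟨M, hM⟩ := hc
  exact ⟨M, fun n As Bs h1 h2 h3 => hM n As _ h1 (fun i => (h2 i).inter hB) fun i j hij =>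
    (h3 hij).mono (prod_mono subset_rfl inter_subset_left) (prod_mono subset_rfl inter_subset_left)⟩

lemma IsBimeasure.inter (hQ : IsBimeasure Q₀) {B : Set X} (hB : MeasurableSet B) :
    IsBimeasure fun A' B' => Q₀ A' (B' ∩ B) :=
  ⟨fun A hA => (hQ.right A hA).inter hB, fun _ hB' => hQ.left _ (hB'.inter hB)⟩

lemma HasBoundedRectangleVariation.swap (hc : HasBoundedRectangleVariation Q₀) :
    HasBoundedRectangleVariation fun B A => Q₀ A B := by
  obtain ⟨M, hM⟩ := hc
  exact ⟨M, fun n Bs As h1 h2 h3 => hM n As Bs h2 h1 fun i j hij => disjoint_prod_swap.1 (h3 hij)⟩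

lemma IsBimeasure.swap (hQ : IsBimeasure Q₀) : IsBimeasure fun B A => Q₀ A B :=
  ⟨hQ.left, hQ.right⟩

lemma rectangleVariation_le_swap (hc : HasBoundedRectangleVariation Q₀) {A : Set T} {B : Set X}
    (hA : MeasurableSet A) (hB : MeasurableSet B) :
    rectangleVariation Q₀ A B ≤ rectangleVariation (fun B A => Q₀ A B) B A := by
  refine nuOf_le fun n As Bs h1 h2 h3 h4 => ?_
  have := sum_le_nuOf (A := B) (hc.swap.inter hA) (fun i => Bs i ∩ B) As
    (fun i => (h3 i).inter hB) (fun i => inter_subset_right) h1 fun i j hij =>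
      disjoint_prod_swap.2 ((h4 hij).mono (prod_mono subset_rfl inter_subset_left)
        (prod_mono subset_rfl inter_subset_left))
  simpa only [rectangleVariation, inter_eq_left.2 (h2 _)] using this

lemma rectangleVariation_swap (hc : HasBoundedRectangleVariation Q₀) {A : Set T} {B : Set X}
    (hA : MeasurableSet A) (hB : MeasurableSet B) :
    rectangleVariation (fun B A => Q₀ A B) B A = rectangleVariation Q₀ A B :=
  le_antisymm (rectangleVariation_le_swap hc.swap hB hA) (rectangleVariation_le_swap hc hA hB)

lemma abs_le_rectangleVariation (hc : HasBoundedRectangleVariation Q₀) {A : Set T} {B : Set X}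
    (hA : MeasurableSet A) (hB : MeasurableSet B) : |Q₀ A B| ≤ rectangleVariation Q₀ A B := by
  simpa [rectangleVariation] using sum_le_nuOf (ι := Unit) (A := A) (hc.inter hB)
    (fun _ => A) (fun _ => B) (fun _ => hA) (fun _ => subset_rfl) (fun _ => hB) (fun i j hij => (hij rfl).elim)

lemma IsCountablyAdditive.congr {m m' : Set T → ℝ} (h : IsCountablyAdditive m)
    (heq : ∀ s, MeasurableSet s → m s = m' s) : IsCountablyAdditive m' := by
  refine ⟨by rw [← heq ∅ .empty, h.1], fun f hf hd => ?_⟩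
  simpa only [heq _ (hf _), heq _ (MeasurableSet.iUnion hf)] using h.2 f hf hd

lemma isBimeasure_rectangleVariation (hQ : IsBimeasure Q₀)
    (hc : HasBoundedRectangleVariation Q₀) : IsBimeasure (rectangleVariation Q₀) where
  left _ hB := isCountablyAdditive_nuOf (hQ.inter hB) (hc.inter hB)
  right _ hA := (isCountablyAdditive_nuOf (hQ.swap.inter hA) (hc.swap.inter hA)).congr
    fun _ hB => rectangleVariation_swap hc hA hB

/-- A bimeasure of bounded variation is the difference of two nonnegative bimeasures adding up to
its variation. -/
lemma exists_jordan_bimeasure (hQ : IsBimeasure Q₀) (hc : HasBoundedRectangleVariation Q₀) :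
    ∃ P N : Set T → Set X → ℝ, IsBimeasure P ∧ IsBimeasure N ∧
      (∀ A B, MeasurableSet A → MeasurableSet B → 0 ≤ P A B) ∧
      (∀ A B, MeasurableSet A → MeasurableSet B → 0 ≤ N A B) ∧
      (∀ A B, Q₀ A B = P A B - N A B) ∧ ∀ A, P A univ + N A univ = nuOf Q₀ A := by
  have hV := isBimeasure_rectangleVariation hQ hc
  refine ⟨fun A B => 2⁻¹ * (rectangleVariation Q₀ A B + Q₀ A B),
    fun A B => 2⁻¹ * (rectangleVariation Q₀ A B - Q₀ A B),
    ⟨fun A hA => ((hV.right A hA).add (hQ.right A hA)).const_mul _,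
      fun B hB => ((hV.left B hB).add (hQ.left B hB)).const_mul _⟩,
    ⟨fun A hA => ((hV.right A hA).sub (hQ.right A hA)).const_mul _,
      fun B hB => ((hV.left B hB).sub (hQ.left B hB)).const_mul _⟩,
    fun A B hA hB => ?_, fun A B hA hB => ?_, fun A B => by ring, fun A => ?_⟩
  · have := abs_le.1 (abs_le_rectangleVariation hc hA hB)
    dsimp only; linarith [this.1]
  · have := abs_le.1 (abs_le_rectangleVariation hc hA hB)
    dsimp only; linarith [this.2]
  · rw [← rectangleVariation_univ]; ring

end nuOf

section Kernel

variable {T X : Type*} [MeasurableSpace T] [MeasurableSpace X]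

lemma measure_le_of_forall_real_le {μ ν : Measure T} [IsFiniteMeasure μ] [IsFiniteMeasure ν]
    (h : ∀ A, MeasurableSet A → μ.real A ≤ ν.real A) : μ ≤ ν :=
  Measure.le_iff.2 fun A hA =>
    (ENNReal.toReal_le_toReal (measure_ne_top _ _) (measure_ne_top _ _)).1 (h A hA)

lemma IsCountablyAdditive.exists_density {m : Set T → ℝ} (h : IsCountablyAdditive m)
    (h0 : ∀ A, MeasurableSet A → 0 ≤ m A) (μ : Measure T) [IsFiniteMeasure μ]
    (hμ : ∀ A, MeasurableSet A → m A ≤ μ.real A) :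
    ∃ f : T → ℝ, Measurable f ∧ Integrable f μ ∧
      ∀ A, MeasurableSet A → ∫ t in A, f t ∂μ = m A := by
  obtain ⟨ν, hν, hνm⟩ := h.exists_measure_real h0
  have hle : ν ≤ μ := measure_le_of_forall_real_le fun A hA => (hνm A hA).trans_le (hμ A hA)
  refine ⟨fun t => (ν.rnDeriv μ t).toReal, (Measure.measurable_rnDeriv _ _).ennreal_toReal,
    Measure.integrable_toReal_rnDeriv, fun A hA => ?_⟩
  rw [Measure.setIntegral_toReal_rnDeriv hle.absolutelyContinuous, hνm A hA]

/-- Densities of the measures `P · (C n)` decrease to the density of `P · C` when the sets `C n`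
decrease to `C`. -/
lemma ae_tendsto_density {P : Set T → Set X → ℝ} (hP : IsBimeasure P)
    (h0 : ∀ A B, MeasurableSet A → MeasurableSet B → 0 ≤ P A B) {μ : Measure T}
    {C : ℕ → Set X} (hC : ∀ n, MeasurableSet (C n)) (hanti : Antitone C)
    {f : ℕ → T → ℝ} {g : T → ℝ} (hf : ∀ n, Integrable (f n) μ) (hg : Integrable g μ)
    (hfP : ∀ n A, MeasurableSet A → ∫ t in A, f n t ∂μ = P A (C n))
    (hgP : ∀ A, MeasurableSet A → ∫ t in A, g t ∂μ = P A (⋂ n, C n)) :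
    ∀ᵐ t ∂μ, Tendsto (fun n => f n t) atTop (𝓝 (g t)) := by
  refine tendsto_of_integral_tendsto_of_antitone hf hg ?_ ?_ ?_
  · obtain ⟨ν, hν, hνm⟩ := (hP.right univ .univ).exists_measure_real (h0 univ · .univ)
    have := tendsto_measure_iInter_atTop (μ := ν) (fun n => (hC n).nullMeasurableSet) hanti
      ⟨0, measure_ne_top _ _⟩
    have := (ENNReal.tendsto_toReal (measure_ne_top ν (⋂ n, C n))).comp this
    simp only [Function.comp_def, ← measureReal_def, hνm _ (hC _), hνm _ (.iInter hC)] at this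
    simpa only [← setIntegral_univ (μ := μ), hfP _ _ .univ, hgP _ .univ] using this
  · have : ∀ᵐ t ∂μ, ∀ n, f (n + 1) t ≤ f n t := ae_all_iff.2 fun n =>
      ae_le_of_forall_setIntegral_le (hf _) (hf _) fun A hA _ => by
        rw [hfP _ _ hA, hfP _ _ hA]
        exact (hP.right A hA).mono (h0 A · hA) (hC _) (hC _) (hanti n.le_succ)
    filter_upwards [this] with t ht using antitone_nat_of_succ_le ht
  · exact ae_all_iff.2 fun n => ae_le_of_forall_setIntegral_le hg (hf _) fun A hA _ => by
      rw [hfP _ _ hA, hgP _ hA]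
      exact (hP.right A hA).mono (h0 A · hA) (.iInter hC) (hC _) (iInter_subset _ _)

lemma setIntegral_kernel_real (μ : Measure T) (κ : Kernel T X) [IsFiniteKernel κ] (A : Set T)
    {B : Set X} (hB : MeasurableSet B) :
    ∫ t in A, (κ t).real B ∂μ = (κ ∘ₘ μ.restrict A).real B := by
  simp only [measureReal_def]
  rw [Measure.bind_apply hB κ.aemeasurable, integral_toReal]
  · exact (κ.measurable_coe hB).aemeasurable
  · exact ae_of_all _ fun t => measure_lt_top _ _

lemma ae_isRatStieltjesPoint {P : Set T → Set ℝ → ℝ} (hP : IsBimeasure P)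
    (h0 : ∀ A B, MeasurableSet A → MeasurableSet B → 0 ≤ P A B) {μ : Measure T}
    [IsFiniteMeasure μ] (hμ : ∀ A, MeasurableSet A → μ.real A = P A univ) {f : T → ℚ → ℝ}
    (hf : ∀ q, Integrable (fun t => f t q) μ)
    (hfP : ∀ (q : ℚ) A, MeasurableSet A → ∫ t in A, f t q ∂μ = P A (Iic (q : ℝ))) :
    ∀ᵐ t ∂μ, IsRatStieltjesPoint f t := by
  have hmono : ∀ᵐ t ∂μ, ∀ q r : ℚ, q ≤ r → f t q ≤ f t r := by
    simp only [ae_all_iff]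
    intro q r hqr
    refine ae_le_of_forall_setIntegral_le (hf _) (hf _) fun A hA _ => ?_
    rw [hfP _ _ hA, hfP _ _ hA]
    exact (hP.right A hA).mono (h0 A · hA) measurableSet_Iic measurableSet_Iic
      (Iic_subset_Iic.2 (mod_cast hqr))
  have hcast : Tendsto (fun n : ℕ => ((n : ℚ) : ℝ)) atTop atTop := by
    simpa using tendsto_natCast_atTop_atTop (R := ℝ)
  have hbot : ∀ᵐ t ∂μ, Tendsto (fun n : ℕ => f t (-n)) atTop (𝓝 0) := by
    refine ae_tendsto_density hP h0 (C := fun n : ℕ => Iic (((-n : ℚ) : ℝ)))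
      (fun n => measurableSet_Iic) (fun m n h => Iic_subset_Iic.2 ?_) (fun n => hf _)
      (integrable_zero _ _ _) (fun n => hfP _) fun A hA => ?_
    · exact_mod_cast neg_le_neg (Nat.cast_le.2 h)
    · rw [show ⋂ n : ℕ, Iic (((-n : ℚ) : ℝ)) = ∅ from ?_, (hP.right A hA).1]
      · simp
      · refine eq_empty_of_forall_notMem fun x hx => ?_
        obtain ⟨n, hn⟩ := exists_nat_gt (-x)
        have := mem_iInter.1 hx n
        simp only [mem_Iic, Rat.cast_neg, Rat.cast_natCast] at this
        linarith
  have htop : ∀ᵐ t ∂μ, Tendsto (fun n : ℕ => 1 - f t n) atTop (𝓝 0) := by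
    refine ae_tendsto_density hP h0 (C := fun n : ℕ => (Iic ((n : ℚ) : ℝ))ᶜ)
      (fun n => measurableSet_Iic.compl) (fun m n h => ?_)
      (fun n => (integrable_const 1).sub (hf _))
      (integrable_zero _ _ _) (fun n A hA => ?_) fun A hA => ?_
    · exact compl_subset_compl.2 (Iic_subset_Iic.2 (mod_cast h))
    · rw [integral_sub (integrable_const 1) (hf _).integrableOn, hfP _ _ hA,
        (hP.right A hA).compl measurableSet_Iic, ← hμ A hA]
      simp
    · rw [show ⋂ n : ℕ, (Iic ((n : ℚ) : ℝ))ᶜ = ∅ from ?_, (hP.right A hA).1]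
      · simp
      · refine eq_empty_of_forall_notMem fun x hx => ?_
        obtain ⟨n, hn⟩ := exists_nat_gt x
        have := mem_iInter.1 hx n
        simp only [mem_compl_iff, mem_Iic, Rat.cast_natCast] at this
        linarith
  have hright : ∀ᵐ t ∂μ, ∀ q : ℚ,
      Tendsto (fun n : ℕ => f t (q + 1 / (n + 1))) atTop (𝓝 (f t q)) := by
    refine ae_all_iff.2 fun q => ?_
    refine ae_tendsto_density hP h0 (C := fun n : ℕ => Iic (((q + 1 / (n + 1) : ℚ) : ℝ)))
      (fun n => measurableSet_Iic) (fun m n h => Iic_subset_Iic.2 ?_) (fun n => hf _)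
      (hf q) (fun n => hfP _) fun A hA => ?_
    · have : (m : ℚ) ≤ n := mod_cast h
      exact_mod_cast (by gcongr : q + 1 / ((n : ℚ) + 1) ≤ q + 1 / (m + 1))
    · rw [hfP q A hA]
      congr 1
      ext x
      simp only [mem_Iic, mem_iInter]
      refine ⟨fun h n => h.trans (Rat.cast_le.2 ?_), fun h => ?_⟩
      · have : (0 : ℚ) < 1 / (n + 1) := by positivity
        linarith
      · have := tendsto_one_div_add_atTop_nhds_zero_nat (𝕜 := ℝ).const_add (q : ℝ)
        rw [add_zero] at this
        exact ge_of_tendsto' this fun n => by simpa using h n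
  filter_upwards [hmono, hbot, htop, hright] with t h1 h2 h3 h4
  have hm : Monotone (f t) := h1
  refine ⟨hm, ?_, ?_, fun q => le_antisymm ?_ ?_⟩
  · rw [tendsto_iff_tendsto_subseq_of_monotone hm (tendsto_natCast_atTop_atTop (R := ℚ))]
    simpa [Function.comp_def] using h3.const_sub 1
  · have hanti : Antitone fun q : ℚ => f t (-q) := fun q r h => hm (neg_le_neg h)
    have := (tendsto_iff_tendsto_subseq_of_antitone hanti
      (tendsto_natCast_atTop_atTop (R := ℚ))).2 h2
    simpa [Function.comp_def] using this.comp tendsto_neg_atBot_atTop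
  · refine ge_of_tendsto' (h4 q) fun n => ?_
    have hn : q < q + 1 / ((n : ℚ) + 1) := lt_add_of_pos_right _ (by positivity)
    refine ciInf_le (f := fun r : Ioi q => f t r) ⟨f t q, ?_⟩ ⟨_, hn⟩
    rintro _ ⟨r, rfl⟩
    exact hm (le_of_lt r.2)
  · exact le_ciInf fun r => hm (le_of_lt r.2)

lemma exists_markovKernel_real {P : Set T → Set ℝ → ℝ} (hP : IsBimeasure P)
    (h0 : ∀ A B, MeasurableSet A → MeasurableSet B → 0 ≤ P A B) (μ : Measure T)
    [IsFiniteMeasure μ] (hμ : ∀ A, MeasurableSet A → μ.real A = P A univ) :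
    ∃ κ : Kernel T ℝ, IsMarkovKernel κ ∧ ∀ A B, MeasurableSet A → MeasurableSet B →
      P A B = ∫ t in A, (κ t).real B ∂μ := by
  have hdens : ∀ q : ℚ, ∃ f : T → ℝ, Measurable f ∧ Integrable f μ ∧
      ∀ A, MeasurableSet A → ∫ t in A, f t ∂μ = P A (Iic (q : ℝ)) := fun q =>
    (hP.left _ measurableSet_Iic).exists_density (h0 · _ · measurableSet_Iic) μ fun A hA => by
      rw [hμ A hA]
      exact (hP.right A hA).mono (h0 A · hA) measurableSet_Iic .univ (subset_univ _)
  choose g hgm hgi hgP using hdens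
  let f : T → ℚ → ℝ := fun t q => g q t
  have hf : Measurable f := measurable_pi_lambda _ hgm
  let κ : Kernel T ℝ := ⟨fun t => (stieltjesOfMeasurableRat f hf t).measure,
    measurable_measure_stieltjesOfMeasurableRat hf⟩
  have hκ : IsMarkovKernel κ := ⟨fun t => instIsProbabilityMeasure_stieltjesOfMeasurableRat hf t⟩
  refine ⟨κ, hκ, fun A B hA hB => ?_⟩
  rw [setIntegral_kernel_real μ κ A hB]
  refine (hP.right A hA).ext_of_generateFrom (C := ⋃ q : ℚ, {Iic (q : ℝ)})
    (by rw [← Real.borel_eq_generateFrom_Iic_rat]; exact BorelSpace.measurable_eq)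
    Real.isPiSystem_Iic_rat (.of_measureReal (κ ∘ₘ μ.restrict A)) ?_ ?_ hB
  · rw [← setIntegral_kernel_real μ κ A .univ, ← hμ A hA]
    simp
  · simp only [iUnion_singleton_eq_range, mem_range, forall_exists_index, forall_apply_eq_imp_iff]
    intro q
    rw [← setIntegral_kernel_real μ κ A measurableSet_Iic, ← hgP q A hA]
    refine integral_congr_ae (ae_restrict_of_ae ?_)
    filter_upwards [ae_isRatStieltjesPoint hP h0 hμ hgi hgP] with t ht
    have : (κ t).real (Iic (q : ℝ)) = stieltjesOfMeasurableRat f hf t q := by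
      rw [measureReal_def, ← ENNReal.toReal_ofReal (stieltjesOfMeasurableRat_nonneg hf t q),
        ← measure_stieltjesOfMeasurableRat_Iic]
      rfl
    rw [this, stieltjesOfMeasurableRat_eq, toRatCDF_of_isRatStieltjesPoint ht]

/-- A nonnegative bimeasure whose first marginal is dominated by `ν` disintegrates with respect to
`ν` along a sub-Markov kernel. -/
lemma exists_subMarkovKernel [StandardBorelSpace X] {P : Set T → Set X → ℝ} (hP : IsBimeasure P)
    (h0 : ∀ A B, MeasurableSet A → MeasurableSet B → 0 ≤ P A B) (ν : Measure T)
    [IsFiniteMeasure ν] (hν : ∀ A, MeasurableSet A → P A univ ≤ ν.real A) :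
    ∃ κ : Kernel T X, (∀ t, κ t univ ≤ 1) ∧ ∀ A B, MeasurableSet A → MeasurableSet B →
      P A B = ∫ t in A, (κ t).real B ∂ν := by
  let e := embeddingReal X
  have he : MeasurableEmbedding e := measurableEmbedding_embeddingReal X
  obtain ⟨μ, hμfin, hμ⟩ := (hP.left univ .univ).exists_measure_real (h0 · _ · .univ)
  have hle : μ ≤ ν := measure_le_of_forall_real_le fun A hA => (hμ A hA).trans_le (hν A hA)
  obtain ⟨κ, hκ, hκP⟩ := exists_markovKernel_real (P := fun A C => P A (e ⁻¹' C))
    ⟨fun A hA => (hP.right A hA).preimage he.measurable, fun C hC => hP.left _ (he.measurable hC)⟩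
    (fun A C hA hC => h0 _ _ hA (he.measurable hC)) μ hμ
  let g : T → ENNReal := fun t => min (μ.rnDeriv ν t) 1
  have hg : Measurable g := (Measure.measurable_rnDeriv _ _).min measurable_const
  have hgr : g =ᵐ[ν] μ.rnDeriv ν := by
    filter_upwards [Measure.rnDeriv_le_one_of_le hle] with t ht using min_eq_left ht
  let η : Kernel T X := ⟨fun t => g t • κ.comapRight he t,
    Measure.measurable_of_measurable_coe _ fun B hB =>
      hg.mul ((κ.comapRight he).measurable_coe hB)⟩
  have hη : ∀ t B, MeasurableSet B → η t B = g t * κ t (e '' B) := fun t B hB => by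
    rw [← κ.comapRight_apply' he t hB]
    rfl
  refine ⟨η, fun t => ?_, fun A B hA hB => ?_⟩
  · rw [hη t _ .univ]
    exact mul_le_one' (min_le_right _ _) prob_le_one
  · have := hκP A (e '' B) hA (he.measurableSet_image.2 hB)
    rw [preimage_image_eq _ he.injective] at this
    rw [this, ← setIntegral_rnDeriv_smul hle.absolutelyContinuous hA]
    refine integral_congr_ae (ae_restrict_of_ae ?_)
    filter_upwards [hgr] with t ht
    simp only [measureReal_def]
    rw [hη t B hB, ht, ENNReal.toReal_mul, smul_eq_mul]

/-- A signed measure on a product is determined by its values on rectangles. -/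
lemma signedMeasure_ext_prod {Q Q' : SignedMeasure (T × X)}
    (h : ∀ (A : Set T) (B : Set X), MeasurableSet A → MeasurableSet B →
      Q (A ×ˢ B) = Q' (A ×ˢ B)) : Q = Q' := by
  refine VectorMeasure.ext fun s hs => ?_
  refine (IsCountablyAdditive.of_signedMeasure Q).ext_of_generateFrom generateFrom_prod.symm
    isPiSystem_prod (.of_signedMeasure Q') ?_ ?_ hs
  · rw [← univ_prod_univ]
    exact h _ _ .univ .univ
  · rintro _ ⟨A, hA, B, hB, rfl⟩
    exact h A B hA hB

lemma compProd_real_prod (ν : Measure T) [IsFiniteMeasure ν] (κ : Kernel T X) [IsFiniteKernel κ]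
    {A : Set T} {B : Set X} (hA : MeasurableSet A) (hB : MeasurableSet B) :
    (ν ⊗ₘ κ).real (A ×ˢ B) = ∫ t in A, (κ t).real B ∂ν := by
  simp only [measureReal_def]
  rw [Measure.compProd_apply_prod hA hB, integral_toReal]
  · exact (κ.measurable_coe hB).aemeasurable
  · exact ae_of_all _ fun t => measure_lt_top _ _

/-- Countably additive set functions on a standard Borel space are determined by countably many
of their values. -/
lemma exists_countable_determining (X : Type*) [MeasurableSpace X] [StandardBorelSpace X] :
    ∃ C : Set (Set X), C.Countable ∧ (∀ B ∈ C, MeasurableSet B) ∧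
      ∀ m m' : Set X → ℝ, IsCountablyAdditive m → IsCountablyAdditive m' →
        (∀ B ∈ C, m B = m' B) → ∀ B, MeasurableSet B → m B = m' B := by
  have he := measurableEmbedding_embeddingReal X
  let D : Set (Set X) := preimage (embeddingReal X) '' ⋃ q : ℚ, {Iic (q : ℝ)}
  have hD : ‹MeasurableSpace X› = .generateFrom D := by
    rw [← MeasurableSpace.comap_generateFrom, ← Real.borel_eq_generateFrom_Iic_rat,
      ← BorelSpace.measurable_eq, he.comap_eq]
  refine ⟨insert univ D, ((countable_iUnion fun q => countable_singleton _).image _).insert _,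
    ?_, fun m m' hm hm' h B hB => ?_⟩
  · rintro B (rfl | hB)
    · exact .univ
    · rw [hD]
      exact MeasurableSpace.measurableSet_generateFrom hB
  · refine hm.ext_of_generateFrom hD ?_ hm' (h _ (mem_insert _ _))
      (fun s hs => h _ (mem_insert_of_mem _ hs)) hB
    exact Real.isPiSystem_Iic_rat.comap (embeddingReal X)

lemma ae_eq_of_forall_setIntegral_eq [StandardBorelSpace X] {ν : Measure T} [IsFiniteMeasure ν]
    {q q' : T → Set X → ℝ} (hq : ∀ t, IsCountablyAdditive (q t))
    (hq' : ∀ t, IsCountablyAdditive (q' t))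
    (hi : ∀ B, MeasurableSet B → Integrable (fun t => q t B) ν)
    (hi' : ∀ B, MeasurableSet B → Integrable (fun t => q' t B) ν)
    (h : ∀ A B, MeasurableSet A → MeasurableSet B →
      ∫ t in A, q t B ∂ν = ∫ t in A, q' t B ∂ν) :
    ∀ᵐ t ∂ν, ∀ B, MeasurableSet B → q t B = q' t B := by
  obtain ⟨C, hC, hCm, hdet⟩ := exists_countable_determining X
  have : ∀ᵐ t ∂ν, ∀ B ∈ C, q t B = q' t B := (ae_ball_iff hC).2 fun B hB =>
    (hi B (hCm B hB)).ae_eq_of_forall_setIntegral_eq _ _ (hi' B (hCm B hB))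
      fun A hA _ => h A B hA (hCm B hB)
  filter_upwards [this] with t ht using hdet _ _ (hq t) (hq' t) ht

lemma integrable_of_mem_Icc {ν : Measure T} [IsFiniteMeasure ν] {f : T → ℝ} (hf : Measurable f)
    (h : ∀ t, f t ∈ Icc (-1 : ℝ) 1) : Integrable f ν :=
  .of_bound hf.aestronglyMeasurable 1 (ae_of_all _ fun t => abs_le.2 (h t))

end Kernel

/-- Horowitz-type theorem: a bi-(signed-)measure `Q₀` of bounded total variation on
`𝒜 × ℬ`, with `(X, ℬ)` standard Borel, extends uniquely to a finite signed measure `Q` on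
the product σ-algebra, `ν` is a finite measure, and `Q₀(A, B) = ∫_A q(t, B) ν(dt)` for an
essentially unique measurable family `q(t, ·)` of signed measures with values in `[−1,1]`. -/
theorem horowitz_disintegration {T X : Type*} [MeasurableSpace T] [MeasurableSpace X]
    [StandardBorelSpace X] (Q₀ : Set T → Set X → ℝ)
    (ha : ∀ A : Set T, MeasurableSet A → IsCountablyAdditive (fun B => Q₀ A B))
    (hb : ∀ B : Set X, MeasurableSet B → IsCountablyAdditive (fun A => Q₀ A B))
    (hc : ∃ M : ℝ, ∀ (n : ℕ) (As : Fin n → Set T) (Bs : Fin n → Set X),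
      (∀ i, MeasurableSet (As i)) → (∀ i, MeasurableSet (Bs i)) →
      (Pairwise fun i j => Disjoint (As i ×ˢ Bs i) (As j ×ˢ Bs j)) →
      ∑ i, |Q₀ (As i) (Bs i)| ≤ M) :
    (∀ A : Set T, MeasurableSet A → 0 ≤ nuOf Q₀ A) ∧
    IsCountablyAdditive (nuOf Q₀) ∧
    (∃! Q : SignedMeasure (T × X), ∀ (A : Set T) (B : Set X),
      MeasurableSet A → MeasurableSet B → Q (A ×ˢ B) = Q₀ A B) ∧
    (∃ νm : Measure T, IsFiniteMeasure νm ∧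
      (∀ A : Set T, MeasurableSet A → νm A = ENNReal.ofReal (nuOf Q₀ A)) ∧
      ∃ q : T → Set X → ℝ,
        (∀ (t : T) (B : Set X), MeasurableSet B → q t B ∈ Set.Icc (-1 : ℝ) 1) ∧
        (∀ t : T, IsCountablyAdditive (q t)) ∧
        (∀ B : Set X, MeasurableSet B → Measurable fun t => q t B) ∧
        (∀ (A : Set T) (B : Set X), MeasurableSet A → MeasurableSet B →
          Q₀ A B = ∫ t in A, q t B ∂νm) ∧
        (∀ q₁ : T → Set X → ℝ,
          (∀ (t : T) (B : Set X), MeasurableSet B → q₁ t B ∈ Set.Icc (-1 : ℝ) 1) →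
          (∀ t : T, IsCountablyAdditive (q₁ t)) →
          (∀ B : Set X, MeasurableSet B → Measurable fun t => q₁ t B) →
          (∀ (A : Set T) (B : Set X), MeasurableSet A → MeasurableSet B →
            Q₀ A B = ∫ t in A, q₁ t B ∂νm) →
          ∀ᵐ t ∂νm, ∀ B : Set X, MeasurableSet B → q₁ t B = q t B)) := by
  have hQ : IsBimeasure Q₀ := ⟨ha, hb⟩
  have hν := isCountablyAdditive_nuOf hQ hc
  obtain ⟨ν, hνfin, hνm⟩ := hν.exists_measure fun A _ => nuOf_nonneg hc A
  have hνr : ∀ A, MeasurableSet A → ν.real A = nuOf Q₀ A := fun A hA => by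
    rw [measureReal_def, hνm A hA, ENNReal.toReal_ofReal (nuOf_nonneg hc A)]
  obtain ⟨P, N, hP, hN, hP0, hN0, hPN, hsum⟩ := exists_jordan_bimeasure hQ hc
  obtain ⟨κ, hκ1, hκ⟩ := exists_subMarkovKernel hP hP0 ν fun A hA => by
    rw [hνr A hA, ← hsum A]
    exact le_add_of_nonneg_right (hN0 A _ hA .univ)
  obtain ⟨η, hη1, hη⟩ := exists_subMarkovKernel hN hN0 ν fun A hA => by
    rw [hνr A hA, ← hsum A]
    exact le_add_of_nonneg_left (hP0 A _ hA .univ)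
  have : IsFiniteKernel κ := ⟨1, ENNReal.one_lt_top, hκ1⟩
  have : IsFiniteKernel η := ⟨1, ENNReal.one_lt_top, hη1⟩
  have hle : ∀ (μ : Measure X), μ univ ≤ 1 → ∀ B, μ.real B ≤ 1 := fun μ hμ B =>
    ENNReal.toReal_le_of_le_ofReal zero_le_one
      (by simpa using (measure_mono (subset_univ B)).trans hμ)
  have hκm : ∀ B, MeasurableSet B → Measurable fun t => (κ t).real B := fun B hB =>
    (κ.measurable_coe hB).ennreal_toReal
  have hηm : ∀ B, MeasurableSet B → Measurable fun t => (η t).real B := fun B hB =>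
    (η.measurable_coe hB).ennreal_toReal
  have hκi : ∀ B, MeasurableSet B → Integrable (fun t => (κ t).real B) ν := fun B hB =>
    integrable_of_mem_Icc (hκm B hB) fun t =>
      ⟨neg_one_lt_zero.le.trans measureReal_nonneg, hle _ (hκ1 t) B⟩
  have hηi : ∀ B, MeasurableSet B → Integrable (fun t => (η t).real B) ν := fun B hB =>
    integrable_of_mem_Icc (hηm B hB) fun t =>
      ⟨neg_one_lt_zero.le.trans measureReal_nonneg, hle _ (hη1 t) B⟩
  have hq : ∀ t, IsCountablyAdditive fun B => (κ t).real B - (η t).real B := fun t =>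
    (IsCountablyAdditive.of_measureReal (κ t)).sub (.of_measureReal (η t))
  have hint : ∀ (A : Set T) (B : Set X), MeasurableSet A → MeasurableSet B →
      Q₀ A B = ∫ t in A, ((κ t).real B - (η t).real B) ∂ν := fun A B hA hB => by
    rw [integral_sub (hκi B hB).integrableOn (hηi B hB).integrableOn, ← hκ A B hA hB,
      ← hη A B hA hB, hPN A B]
  have hprod : ∀ (A : Set T) (B : Set X), MeasurableSet A → MeasurableSet B →
      ((ν ⊗ₘ κ).toSignedMeasure - (ν ⊗ₘ η).toSignedMeasure) (A ×ˢ B) = Q₀ A B :=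
    fun A B hA hB => by
      rw [sub_apply, Measure.toSignedMeasure_apply_measurable (hA.prod hB),
        Measure.toSignedMeasure_apply_measurable (hA.prod hB), compProd_real_prod ν κ hA hB,
        compProd_real_prod ν η hA hB, ← hκ A B hA hB, ← hη A B hA hB, hPN A B]
  refine ⟨fun A _ => nuOf_nonneg hc A, hν,
    ⟨(ν ⊗ₘ κ).toSignedMeasure - (ν ⊗ₘ η).toSignedMeasure, hprod,
      fun Q hQ' => signedMeasure_ext_prod fun A B hA hB => ?_⟩, ν, hνfin, hνm,
    fun t B => (κ t).real B - (η t).real B, fun t B hB => ⟨?_, ?_⟩, hq,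
    fun B hB => (hκm B hB).sub (hηm B hB), hint, fun q₁ hq₁ hq₁a hq₁m hq₁i => ?_⟩
  · exact (hQ' A B hA hB).trans (hprod A B hA hB).symm
  · linarith [hle _ (hη1 t) B, measureReal_nonneg (μ := κ t) (s := B)]
  · linarith [hle _ (hκ1 t) B, measureReal_nonneg (μ := η t) (s := B)]
  · exact ae_eq_of_forall_setIntegral_eq hq₁a hq
      (fun B hB => integrable_of_mem_Icc (hq₁m B hB) fun t => hq₁ t B hB)
      (fun B hB => (hκi B hB).sub (hηi B hB))
      fun A B hA hB => (hq₁i A B hA hB).symm.trans (hint A B hA hB)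
end
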